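/- arXiv:2310.13151 — 2 statements merged into one kernel-verified Lean document; each statement's English description precedes it below -/
import Mathlib

section
/- Let n ≥ 1, let L ≥ 0 be a real number, and let F : Fin n → ℍ → ℍ be a family of maps each of which is L-Lipschitz for the hyperbolic metric (dist (Fᵢ z) (Fᵢ w) ≤ L · dist z w for all z, w). Suppose u : ℍ → ℍ is a map such that for every z ∈ ℍ, u z minimizes the function x ↦ ∑ i, (dist x (Fᵢ z))² on ℍ (i.e. ∑ i, (dist (u z) (Fᵢ z))² ≤ ∑ i, (dist x (Fᵢ z))² for all x ∈ ℍ). Then u is L-Lipschitz: dist (u z) (u w) ≤ L · dist z w for all z, w ∈ ℍ. -/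
open scoped UpperHalfPlane

theorem pow_add_pow_le_of_add_eq_add {x y c d : ℝ} (hy : 0 ≤ y) (hyc : y ≤ c) (hcx : c ≤ x)
    (h : c + d = x + y) (k : ℕ) : c ^ k + d ^ k ≤ x ^ k + y ^ k := by
  have hmem : c ∈ segment ℝ y x := by
    rw [segment_eq_Icc (hyc.trans hcx)]
    exact ⟨hyc, hcx⟩
  obtain ⟨a, b, ha, hb, hab, rfl⟩ := hmem
  simp only [smul_eq_mul] at *
  obtain rfl : d = b * y + a * x := by
    obtain rfl : b = 1 - a := by linarith
    linarith
  have hx : 0 ≤ x := by linarith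
  have h₁ := (convexOn_pow (𝕜 := ℝ) k).2 hy hx ha hb hab
  have h₂ := (convexOn_pow (𝕜 := ℝ) k).2 hy hx hb ha (by linarith)
  simp only [smul_eq_mul] at h₁ h₂
  calc _ ≤ (a * y ^ k + b * x ^ k) + (b * y ^ k + a * x ^ k) := add_le_add h₁ h₂
    _ = (a + b) * (x ^ k + y ^ k) := by ring
    _ = x ^ k + y ^ k := by rw [hab, one_mul]

/-- Convexity of `t ↦ cosh √t`, in two-point majorization form. -/
theorem cosh_add_cosh_le_of_sq_add_sq_eq {x y c d : ℝ} (hyc : y ^ 2 ≤ c ^ 2)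
    (hcx : c ^ 2 ≤ x ^ 2) (h : c ^ 2 + d ^ 2 = x ^ 2 + y ^ 2) :
    Real.cosh c + Real.cosh d ≤ Real.cosh x + Real.cosh y := by
  refine hasSum_le (fun k => ?_) ((Real.hasSum_cosh c).add (Real.hasSum_cosh d))
    ((Real.hasSum_cosh x).add (Real.hasSum_cosh y))
  rw [← add_div, ← add_div]
  simp only [pow_mul]
  gcongr ?_ / _
  exact pow_add_pow_le_of_add_eq_add (sq_nonneg y) hyc hcx h k

/-- The midpoint of two points, characterized by the hyperbolic median formula. -/
theorem UpperHalfPlane.exists_cosh_dist_midpoint (x y : ℍ) :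
    ∃ m : ℍ, ∀ p : ℍ, 2 * Real.cosh (dist x y / 2) * Real.cosh (dist m p) =
      Real.cosh (dist x p) + Real.cosh (dist y p) := by
  have hx := x.im_pos
  have hy := y.im_pos
  set c := Real.cosh (dist x y / 2)
  have hcpos : 0 < c := Real.cosh_pos _
  have hsq : 2 * c ^ 2 = 1 + Real.cosh (dist x y) := by
    have := Real.cosh_two_mul (dist x y / 2)
    have h' := Real.cosh_sq (dist x y / 2)
    rw [mul_div_cancel₀ _ (two_ne_zero' ℝ)] at this
    linarith
  rw [UpperHalfPlane.cosh_dist'] at hsq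
  have hs : 4 * c ^ 2 * (x.im * y.im) = (x.re - y.re) ^ 2 + (x.im + y.im) ^ 2 := by
    field_simp at hsq
    linarith
  refine ⟨⟨⟨(x.re * y.im + y.re * x.im) / (x.im + y.im), 2 * c * (x.im * y.im) / (x.im + y.im)⟩,
    by positivity⟩, fun p => ?_⟩
  have hp := p.im_pos
  rw [UpperHalfPlane.cosh_dist', UpperHalfPlane.cosh_dist', UpperHalfPlane.cosh_dist']
  simp only [UpperHalfPlane.re, UpperHalfPlane.im] at *
  field_simp
  linear_combination (x : ℂ).im * (y : ℂ).im * hs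

/-- The Bruhat–Tits (CN) inequality in the hyperbolic plane. -/
theorem UpperHalfPlane.exists_dist_sq_le (x y : ℍ) :
    ∃ m : ℍ, ∀ p : ℍ,
      dist m p ^ 2 ≤ (dist x p ^ 2 + dist y p ^ 2) / 2 - dist x y ^ 2 / 4 := by
  obtain ⟨m, hm⟩ := UpperHalfPlane.exists_cosh_dist_midpoint x y
  refine ⟨m, fun p => ?_⟩
  specialize hm p
  have h₁ : dist x y ≤ dist x p + dist y p := dist_triangle_right x y p
  have h₂ : dist x p ≤ dist x y + dist y p := dist_triangle x y p
  have h₃ : dist y p ≤ dist x y + dist x p := dist_triangle_left y p x |>.trans_eq (by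
    rw [dist_comm x y])
  have hl : 0 ≤ dist x y := dist_nonneg
  have hh : 0 ≤ dist m p := dist_nonneg
  generalize dist x y = l at *
  generalize dist x p = a at *
  generalize dist y p = b at *
  generalize dist m p = h at *
  set s := (a ^ 2 + b ^ 2) / 2 - l ^ 2 / 4 with hs
  have hs0 : 0 ≤ s := by nlinarith [sq_nonneg (a - b)]
  have hr := Real.sq_sqrt hs0
  have hr0 := Real.sqrt_nonneg s
  set r := √s
  have heron : (a ^ 2 - b ^ 2) ^ 2 ≤ (2 * r * l) ^ 2 := by
    have : 0 ≤ (l ^ 2 - (a - b) ^ 2) * ((a + b) ^ 2 - l ^ 2) :=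
      mul_nonneg (by nlinarith) (by nlinarith)
    rw [mul_pow, mul_pow, hr]
    nlinarith
  have habs := abs_le.1 (abs_le_of_sq_le_sq heron (by positivity))
  have key : Real.cosh a + Real.cosh b ≤ Real.cosh (r + l / 2) + Real.cosh (r - l / 2) := by
    apply cosh_add_cosh_le_of_sq_add_sq_eq <;> nlinarith
  rw [Real.cosh_add, Real.cosh_sub] at key
  have hle : Real.cosh h ≤ Real.cosh r :=
    le_of_mul_le_mul_left (by linarith) (mul_pos two_pos (Real.cosh_pos (l / 2)))
  rw [Real.cosh_le_cosh, abs_of_nonneg hh, abs_of_nonneg hr0] at hle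
  rw [← hr]
  gcongr

/-- The sum of the squared diagonals of a quadrilateral is at most that of its sides. -/
theorem UpperHalfPlane.dist_sq_add_dist_sq_le (p q y x : ℍ) :
    dist y p ^ 2 + dist x q ^ 2 ≤
      dist x p ^ 2 + dist y q ^ 2 + dist p q ^ 2 + dist x y ^ 2 := by
  obtain ⟨m, hm⟩ := UpperHalfPlane.exists_dist_sq_le y p
  have hq := hm q
  have hx := hm x
  have ht : dist x q ≤ dist m x + dist m q := dist_triangle_left x q m
  have hsq : dist x q ^ 2 ≤ (dist m x + dist m q) ^ 2 := by gcongr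
  rw [dist_comm y x, dist_comm p x] at hx
  nlinarith [sq_nonneg (dist m x - dist m q)]

/-- The variance inequality for a center of mass. -/
theorem UpperHalfPlane.sum_dist_sq_add_le {ι : Type*} [Fintype ι] (p : ι → ℍ) (x : ℍ)
    (hx : ∀ y, ∑ i, dist x (p i) ^ 2 ≤ ∑ i, dist y (p i) ^ 2) (y : ℍ) :
    ∑ i, dist x (p i) ^ 2 + Fintype.card ι * dist x y ^ 2 ≤ ∑ i, dist y (p i) ^ 2 := by
  have step : ∀ (k : ℕ) (y : ℍ), ∑ i, dist x (p i) ^ 2 +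
      (1 - (1 / 2) ^ k) * (Fintype.card ι * dist x y ^ 2) ≤ ∑ i, dist y (p i) ^ 2 := by
    intro k
    induction k with
    | zero => simpa using hx
    | succ k ih =>
      intro y
      obtain ⟨m, hm⟩ := UpperHalfPlane.exists_dist_sq_le x y
      have hmy : dist m y ≤ dist x y / 2 := by
        refine abs_le_of_sq_le_sq' ?_ (by positivity) |>.2
        have := hm y
        rw [dist_self] at this
        linarith
      have hxm : dist x y / 2 ≤ dist x m := by linarith [dist_triangle x m y]
      have hsum : ∑ i, dist m (p i) ^ 2 ≤ (∑ i, dist x (p i) ^ 2 + ∑ i, dist y (p i) ^ 2) / 2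
          - Fintype.card ι * dist x y ^ 2 / 4 := by
        calc _ ≤ ∑ i, ((dist x (p i) ^ 2 + dist y (p i) ^ 2) / 2 - dist x y ^ 2 / 4) :=
              Finset.sum_le_sum fun i _ => hm (p i)
          _ = _ := by
              rw [Finset.sum_sub_distrib, ← Finset.sum_div, Finset.sum_add_distrib]
              simp
              ring
      have hk : (0 : ℝ) ≤ 1 - (1 / 2) ^ k :=
        sub_nonneg.2 (pow_le_one₀ (by norm_num) (by norm_num))
      have hlow : (1 - (1 / 2) ^ k) * (Fintype.card ι * (dist x y / 2) ^ 2) ≤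
          (1 - (1 / 2) ^ k) * (Fintype.card ι * dist x m ^ 2) := by gcongr
      have := ih m
      rw [pow_succ]
      linarith
  have hlim : Filter.Tendsto (fun k : ℕ => ∑ i, dist x (p i) ^ 2 +
      (1 - (1 / 2 : ℝ) ^ k) * (Fintype.card ι * dist x y ^ 2)) Filter.atTop
      (nhds (∑ i, dist x (p i) ^ 2 + (1 - 0) * (Fintype.card ι * dist x y ^ 2))) :=
    ((tendsto_const_nhds.sub (tendsto_pow_atTop_nhds_zero_of_lt_one
      (by norm_num) (by norm_num))).mul_const _).const_add _
  simpa using le_of_tendsto' hlim fun k => step k y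

/-- The Karcher center of mass of a family of `L`-Lipschitz maps of the hyperbolic
plane is again `L`-Lipschitz. -/
theorem center_of_mass_lipschitz (n : ℕ) (hn : 1 ≤ n) (L : ℝ) (hL : 0 ≤ L)
    (F : Fin n → ℍ → ℍ)
    (hF : ∀ i, ∀ z w : ℍ, dist (F i z) (F i w) ≤ L * dist z w)
    (u : ℍ → ℍ)
    (hu : ∀ z : ℍ, ∀ x : ℍ,
      ∑ i, (dist (u z) (F i z)) ^ 2 ≤ ∑ i, (dist x (F i z)) ^ 2) :
    ∀ z w : ℍ, dist (u z) (u w) ≤ L * dist z w := by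
  intro z w
  have hz := UpperHalfPlane.sum_dist_sq_add_le (fun i => F i z) (u z) (hu z) (u w)
  have hw := UpperHalfPlane.sum_dist_sq_add_le (fun i => F i w) (u w) (hu w) (u z)
  have hquad : ∑ i, (dist (u w) (F i z) ^ 2 + dist (u z) (F i w) ^ 2) ≤
      ∑ i, (dist (u z) (F i z) ^ 2 + dist (u w) (F i w) ^ 2 + (L * dist z w) ^ 2 +
        dist (u z) (u w) ^ 2) := by
    refine Finset.sum_le_sum fun i _ =>
      (UpperHalfPlane.dist_sq_add_dist_sq_le (F i z) (F i w) (u w) (u z)).trans ?_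
    gcongr
    exact hF i z w
  simp only [Finset.sum_add_distrib, Finset.sum_const, Finset.card_univ, Fintype.card_fin,
    nsmul_eq_mul] at hz hw hquad
  rw [dist_comm (u w) (u z)] at hw
  have hn' : (0 : ℝ) < n := by exact_mod_cast hn
  have hsq : dist (u z) (u w) ^ 2 ≤ (L * dist z w) ^ 2 :=
    le_of_mul_le_mul_left (by linarith) hn'
  exact (abs_le_of_sq_le_sq' hsq (by positivity)).2
end

section
/- Let Γ₀ ≤ Γ₁ be subgroups of SL(2,ℝ) with Γ₀ of finite index in Γ₁, let ρ : Γ₁ →* SL(2,ℝ) be a group homomorphism, and let L ≥ 0. Suppose there exists an L-Lipschitz map u₀ : ℍ → ℍ (for the hyperbolic metric) which is ρ-equivariant with respect to Γ₀, i.e. u₀ (γ • z) = ρ(γ) • u₀(z) for all γ ∈ Γ₀ and z ∈ ℍ. Then there exists an L-Lipschitz map u : ℍ → ℍ which is ρ-equivariant with respect to all of Γ₁, i.e. u (γ • z) = ρ(γ) • u(z) for all γ ∈ Γ₁ and z ∈ ℍ. -/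
open scoped UpperHalfPlane MatrixGroups

namespace UpperHalfPlane

/-- The positive definite binary quadratic form `(a, b) ↦ |a z + b|² / im z` of determinant one
attached to a point `z` of the upper half plane. -/
noncomputable def quadForm (z : ℍ) (a b : ℝ) : ℝ :=
  ((a * z.re + b) ^ 2 + (a * z.im) ^ 2) / z.im

lemma quadForm_eq_normSq (z : ℍ) (a b : ℝ) :
    quadForm z a b = Complex.normSq ((a : ℂ) * z + b) / z.im := by
  simp [quadForm, Complex.normSq_apply, sq]

lemma quadForm_pos_of_left_ne_zero (z : ℍ) {a : ℝ} (ha : a ≠ 0) (b : ℝ) :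
    0 < quadForm z a b := by
  have := z.im_pos
  unfold quadForm
  positivity

lemma im_SL_smul (g : SL(2, ℝ)) (z : ℍ) :
    (g • z).im = z.im / Complex.normSq ((g 1 0 : ℂ) * z + g 1 1) := by
  have hg : g • z = (g : GL (Fin 2) ℝ) • z := rfl
  simpa [denom, hg] using UpperHalfPlane.im_smul_eq_div_normSq (g : GL (Fin 2) ℝ) z

lemma quadForm_smul (g : SL(2, ℝ)) (z : ℍ) (a b : ℝ) :
    quadForm (g • z) a b =
      quadForm z (a * g 0 0 + b * g 1 0) (a * g 0 1 + b * g 1 1) := by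
  have hne : (g 1 0 : ℂ) * z + g 1 1 ≠ 0 := by
    simpa [denom] using denom_ne_zero (g : GL (Fin 2) ℝ) z
  rw [quadForm_eq_normSq, quadForm_eq_normSq, im_SL_smul, coe_specialLinearGroup_apply]
  have key : (a : ℂ) * (((g 0 0 : ℂ) * z + g 0 1) / ((g 1 0 : ℂ) * z + g 1 1)) + b =
      (((a * g 0 0 + b * g 1 0 : ℝ) : ℂ) * z + ((a * g 0 1 + b * g 1 1 : ℝ) : ℂ)) /
        ((g 1 0 : ℂ) * z + g 1 1) := by
    rw [eq_div_iff hne, add_mul, mul_assoc, div_mul_cancel₀ _ hne]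
    push_cast
    ring
  have hne' := (Complex.normSq_pos.2 hne).ne'
  simp only [Algebra.algebraMap_self, RingHom.id_apply]
  rw [key, Complex.normSq_div, div_div_div_cancel_right₀ hne']

lemma quadForm_zero_one (z : ℍ) : quadForm z 0 1 = 1 / z.im := by
  simp [quadForm]

lemma quadForm_le_exp_dist_mul (z w : ℍ) (a b : ℝ) :
    quadForm w a b ≤ Real.exp (dist z w) * quadForm z a b := by
  by_cases hab : a = 0 ∧ b = 0
  · simp [quadForm, hab.1, hab.2]
  have hn : a ^ 2 + b ^ 2 ≠ 0 := fun h ↦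
    hab ⟨by nlinarith [sq_nonneg a, sq_nonneg b], by nlinarith [sq_nonneg a, sq_nonneg b]⟩
  let g : SL(2, ℝ) := ⟨!![b / (a ^ 2 + b ^ 2), -a / (a ^ 2 + b ^ 2); a, b], by
    rw [Matrix.det_fin_two_of]; field_simp; ring⟩
  have hQ (x : ℍ) : quadForm x a b = 1 / (g • x).im := by
    rw [← quadForm_zero_one, quadForm_smul]
    simp [g]
  have h := im_le_im_mul_exp_dist (g • z) (g • w)
  rw [dist_smul] at h
  have hz := (g • z).im_pos
  have hw := (g • w).im_pos
  rw [hQ, hQ, mul_one_div, div_le_div_iff₀ hw hz]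
  linarith

lemma dist_le_log_of_quadForm_le {z w : ℍ} {c : ℝ} (hc : 0 < c)
    (h : ∀ a b, quadForm w a b ≤ c * quadForm z a b) : dist z w ≤ Real.log c := by
  have hz := z.im_pos
  have hw := w.im_pos
  have hzw : z.im ≤ c * w.im := by
    have := h 0 1
    rw [quadForm_zero_one, quadForm_zero_one, mul_one_div, div_le_div_iff₀ hw hz] at this
    linarith
  have hwz : w.im ≤ c * z.im := by
    have h1 := h 1 (-z.re)
    have h2 : quadForm z 1 (-z.re) = z.im := by simp [quadForm, sq]
    have h3 : w.im ≤ quadForm w 1 (-z.re) := by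
      rw [quadForm, le_div_iff₀ hw]
      nlinarith [sq_nonneg (1 * w.re + -z.re)]
    linarith [h2 ▸ h1]
  have hc1 : 1 ≤ c := by
    by_contra! hlt
    nlinarith
  have hdisc := discrim_le_zero (a := c * (z.re ^ 2 + z.im ^ 2) / z.im
      - (w.re ^ 2 + w.im ^ 2) / w.im) (b := 2 * (c * z.re / z.im - w.re / w.im))
      (c := c / z.im - 1 / w.im) fun t ↦ by
    have := h t 1
    unfold quadForm at this
    rw [← sub_nonneg] at this
    refine this.trans_eq ?_
    field_simp
    ring
  have hcosh : Real.cosh (dist z w) ≤ Real.cosh (Real.log c) := by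
    rw [cosh_dist', Real.cosh_eq, Real.exp_neg, Real.exp_log hc]
    have : discrim (c * (z.re ^ 2 + z.im ^ 2) / z.im - (w.re ^ 2 + w.im ^ 2) / w.im)
        (2 * (c * z.re / z.im - w.re / w.im)) (c / z.im - 1 / w.im) =
        8 * c * (((z.re - w.re) ^ 2 + z.im ^ 2 + w.im ^ 2) / (2 * z.im * w.im)
          - (c + c⁻¹) / 2) := by
      rw [discrim]
      field_simp
      ring
    rw [this] at hdisc
    have := nonpos_of_mul_nonpos_right hdisc (by positivity)
    linarith
  rw [Real.cosh_le_cosh] at hcosh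
  rwa [abs_of_nonneg dist_nonneg, abs_of_nonneg (Real.log_nonneg hc1)] at hcosh

lemma dist_le_of_quadForm_le {z w : ℍ} {k D : ℝ} (hk : 0 < k)
    (h₁ : ∀ a b, quadForm w a b ≤ k * Real.exp D * quadForm z a b)
    (h₂ : ∀ a b, quadForm z a b ≤ k⁻¹ * Real.exp D * quadForm w a b) : dist z w ≤ D := by
  have d₁ := dist_le_log_of_quadForm_le (by positivity) h₁
  have d₂ := dist_le_log_of_quadForm_le (by positivity) h₂
  rw [Real.log_mul (by positivity) (Real.exp_ne_zero D), Real.log_exp] at d₁ d₂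
  rw [Real.log_inv, dist_comm] at d₂
  linarith

/-- A point `b` is a center of mass of the finite family `x` if its quadratic form is proportional
to the sum of the quadratic forms of the points `x i`. Equivalently, `b` minimizes
`∑ i, cosh (dist b (x i))`. -/
def IsCenterOfMass {ι : Type*} [Fintype ι] (x : ι → ℍ) (b : ℍ) : Prop :=
  ∃ k : ℝ, 0 < k ∧ ∀ s t, quadForm b s t = k * ∑ i, quadForm (x i) s t

section CenterOfMass

variable {ι : Type*} [Fintype ι]

lemma exists_isCenterOfMass [Nonempty ι] (x : ι → ℍ) : ∃ b, IsCenterOfMass x b := by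
  set A := ∑ i, ((x i).re ^ 2 + (x i).im ^ 2) / (x i).im with hA
  set B := ∑ i, (x i).re / (x i).im with hB
  set C := ∑ i, 1 / (x i).im with hC
  have hsum (s t : ℝ) : ∑ i, quadForm (x i) s t = s ^ 2 * A + 2 * s * t * B + t ^ 2 * C := by
    simp only [hA, hB, hC, Finset.mul_sum, ← Finset.sum_add_distrib]
    refine Finset.sum_congr rfl fun i _ ↦ ?_
    have := (x i).im_pos.ne'
    rw [quadForm]
    field_simp
    ring
  have hCpos : 0 < C :=
    Finset.sum_pos (fun i _ ↦ one_div_pos.2 (x i).im_pos) Finset.univ_nonempty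
  have hdet : 0 < A * C - B ^ 2 := by
    have h : 0 < ∑ i, quadForm (x i) 1 (-B / C) := Finset.sum_pos
      (fun i _ ↦ quadForm_pos_of_left_ne_zero (x i) one_ne_zero _) Finset.univ_nonempty
    rw [hsum] at h
    have h' := mul_pos h hCpos
    have e : (1 ^ 2 * A + 2 * 1 * (-B / C) * B + (-B / C) ^ 2 * C) * C = A * C - B ^ 2 := by
      field_simp
      ring
    rwa [e] at h'
  have hr : 0 < √(A * C - B ^ 2) := Real.sqrt_pos.2 hdet
  have hsq := Real.sq_sqrt hdet.le
  set r := √(A * C - B ^ 2)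
  refine ⟨⟨⟨B / C, r / C⟩, div_pos hr hCpos⟩, r⁻¹, inv_pos.2 hr, fun s t ↦ ?_⟩
  rw [hsum]
  change ((s * (B / C) + t) ^ 2 + (s * (r / C)) ^ 2) / (r / C) = _
  field_simp
  rw [hsq]
  ring

lemma IsCenterOfMass.smul {x : ι → ℍ} {b : ℍ} (h : IsCenterOfMass x b) (g : SL(2, ℝ)) :
    IsCenterOfMass (fun i ↦ g • x i) (g • b) := by
  obtain ⟨k, hk, h⟩ := h
  exact ⟨k, hk, fun s t ↦ by simp only [quadForm_smul, h]⟩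

lemma IsCenterOfMass.comp_equiv {κ : Type*} [Fintype κ] {x : ι → ℍ} {b : ℍ}
    (h : IsCenterOfMass x b) (e : κ ≃ ι) : IsCenterOfMass (fun j ↦ x (e j)) b := by
  obtain ⟨k, hk, h⟩ := h
  exact ⟨k, hk, fun s t ↦ by rw [h, e.sum_comp fun i ↦ quadForm (x i) s t]⟩

lemma IsCenterOfMass.dist_le {x y : ι → ℍ} {b c : ℍ} {D : ℝ} (hb : IsCenterOfMass x b)
    (hc : IsCenterOfMass y c) (hD : ∀ i, dist (x i) (y i) ≤ D) : dist b c ≤ D := by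
  obtain ⟨k, hk, hb⟩ := hb
  obtain ⟨l, hl, hc⟩ := hc
  have key (x y : ι → ℍ) (hD : ∀ i, dist (x i) (y i) ≤ D) (s t : ℝ) :
      ∑ i, quadForm (y i) s t ≤ Real.exp D * ∑ i, quadForm (x i) s t := by
    rw [Finset.mul_sum]
    refine Finset.sum_le_sum fun i _ ↦ (quadForm_le_exp_dist_mul (x i) (y i) s t).trans ?_
    have : 0 ≤ quadForm (x i) s t := by
      have := (x i).im_pos
      unfold quadForm
      positivity
    gcongr
    exact hD i
  refine dist_le_of_quadForm_le (k := l / k) (by positivity) (fun s t ↦ ?_) fun s t ↦ ?_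
  · rw [hb, hc]
    calc l * ∑ i, quadForm (y i) s t
        ≤ l * (Real.exp D * ∑ i, quadForm (x i) s t) := by gcongr; exact key x y hD s t
      _ = l / k * Real.exp D * (k * ∑ i, quadForm (x i) s t) := by field_simp
  · rw [hb, hc]
    calc k * ∑ i, quadForm (x i) s t
        ≤ k * (Real.exp D * ∑ i, quadForm (y i) s t) := by
          gcongr; exact key y x (fun i ↦ dist_comm (x i) (y i) ▸ hD i) s t
      _ = (l / k)⁻¹ * Real.exp D * (l * ∑ i, quadForm (y i) s t) := by field_simp

lemma IsCenterOfMass.unique {x : ι → ℍ} {b c : ℍ} (hb : IsCenterOfMass x b)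
    (hc : IsCenterOfMass x c) : b = c :=
  dist_le_zero.1 <| hb.dist_le hc fun _ ↦ (dist_self _).le

end CenterOfMass

end UpperHalfPlane

/-- Center-of-mass averaging over cosets: an `L`-Lipschitz map of the hyperbolic plane
which is `ρ`-equivariant with respect to a finite index subgroup `Γ₀` of `Γ₁` can be
replaced by an `L`-Lipschitz map which is `ρ`-equivariant with respect to all of `Γ₁`. -/
theorem exists_equivariant_lipschitz_of_finite_index
    (Γ₀ Γ₁ : Subgroup SL(2, ℝ)) (hle : Γ₀ ≤ Γ₁)
    (hfi : (Γ₀.subgroupOf Γ₁).FiniteIndex)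
    (ρ : Γ₁ →* SL(2, ℝ)) (L : ℝ) (hL : 0 ≤ L)
    (u₀ : ℍ → ℍ)
    (hu₀Lip : ∀ z w : ℍ, dist (u₀ z) (u₀ w) ≤ L * dist z w)
    (hu₀equiv : ∀ γ : Γ₁, (γ : SL(2, ℝ)) ∈ Γ₀ →
      ∀ z : ℍ, u₀ ((γ : SL(2, ℝ)) • z) = ρ γ • u₀ z) :
    ∃ u : ℍ → ℍ,
      (∀ z w : ℍ, dist (u z) (u w) ≤ L * dist z w) ∧
      (∀ γ : Γ₁, ∀ z : ℍ, u ((γ : SL(2, ℝ)) • z) = ρ γ • u z) := by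
  have : Fintype (Γ₁ ⧸ Γ₀.subgroupOf Γ₁) := Fintype.ofFinite _
  let F (z : ℍ) : Γ₁ ⧸ Γ₀.subgroupOf Γ₁ → ℍ :=
    Quotient.lift (fun g : Γ₁ ↦ ρ g • u₀ (((g⁻¹ : Γ₁) : SL(2, ℝ)) • z)) fun g h hgh ↦ by
      have hmem : ((g⁻¹ * h : Γ₁) : SL(2, ℝ)) ∈ Γ₀ :=
        Subgroup.mem_subgroupOf.1 (QuotientGroup.leftRel_apply.1 hgh)
      have hu := hu₀equiv (g⁻¹ * h) hmem (((h⁻¹ : Γ₁) : SL(2, ℝ)) • z)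
      rw [← mul_smul, ← Subgroup.coe_mul, mul_assoc, mul_inv_cancel, mul_one] at hu
      change ρ g • u₀ _ = ρ h • u₀ _
      rw [hu, ← mul_smul, ← map_mul, mul_inv_cancel_left]
  have hF_mk (z : ℍ) (g : Γ₁) :
      F z (g : Γ₁ ⧸ Γ₀.subgroupOf Γ₁) = ρ g • u₀ (((g⁻¹ : Γ₁) : SL(2, ℝ)) • z) := rfl
  have hF_equiv (γ : Γ₁) (z : ℍ) (q : Γ₁ ⧸ Γ₀.subgroupOf Γ₁) :
      F ((γ : SL(2, ℝ)) • z) (γ • q) = ρ γ • F z q := by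
    induction q using QuotientGroup.induction_on with
    | H g =>
      rw [MulAction.Quotient.smul_coe, hF_mk, hF_mk, smul_eq_mul, map_mul, mul_smul, smul_smul _ _ z,
        ← Subgroup.coe_mul, mul_inv_rev, inv_mul_cancel_right]
  have hF_lip (z w : ℍ) (q : Γ₁ ⧸ Γ₀.subgroupOf Γ₁) :
      dist (F z q) (F w q) ≤ L * dist z w := by
    induction q using QuotientGroup.induction_on with
    | H g =>
      rw [hF_mk, hF_mk, dist_smul]
      exact (hu₀Lip _ _).trans_eq (by rw [dist_smul])
  choose u hu using fun z ↦ UpperHalfPlane.exists_isCenterOfMass (F z)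
  refine ⟨u, fun z w ↦ (hu z).dist_le (hu w) (hF_lip z w), fun γ z ↦ ?_⟩
  have h := (hu ((γ : SL(2, ℝ)) • z)).comp_equiv (MulAction.toPerm γ)
  simp only [MulAction.toPerm_apply, hF_equiv] at h
  exact h.unique ((hu z).smul (ρ γ))
end
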